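/- arXiv:1812.03093 — 3 statements merged into one kernel-verified Lean document; each statement's English description precedes it below -/
import Mathlib

section
/- A fuzzy metric space (X,M,*) is Lebesgue if and only if the set X' of all accumulation points of (X,τ_M) is compact and for every δ₁ ∈ (0,1) and t₁ > 0 there exist δ₂ ∈ (0,1) and t₂ > 0 such that for each x ∈ X with sup_{a∈X'} M(x,a,t₁) ≤ 1−δ₁ one has sup_{y≠x} M(x,y,t₂) ≤ 1−δ₂. -/
open Filter Topology Set

/-- A fuzzy metric space in the sense of George and Veeramani: a continuous
t-norm `star` on `[0,1]` together with a fuzzy set `M` on `X × X × (0,∞)`. -/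
structure FuzzyMetric (X : Type*) where
  M : X → X → ℝ → ℝ
  star : ℝ → ℝ → ℝ
  star_mem : ∀ a ∈ Set.Icc (0:ℝ) 1, ∀ b ∈ Set.Icc (0:ℝ) 1, star a b ∈ Set.Icc (0:ℝ) 1
  star_comm : ∀ a ∈ Set.Icc (0:ℝ) 1, ∀ b ∈ Set.Icc (0:ℝ) 1, star a b = star b a
  star_assoc : ∀ a ∈ Set.Icc (0:ℝ) 1, ∀ b ∈ Set.Icc (0:ℝ) 1, ∀ c ∈ Set.Icc (0:ℝ) 1,
    star (star a b) c = star a (star b c)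
  star_one : ∀ a ∈ Set.Icc (0:ℝ) 1, star a 1 = a
  star_mono : ∀ a b c d : ℝ, a ∈ Set.Icc (0:ℝ) 1 → b ∈ Set.Icc (0:ℝ) 1 →
    c ∈ Set.Icc (0:ℝ) 1 → d ∈ Set.Icc (0:ℝ) 1 → a ≤ b → c ≤ d → star a c ≤ star b d
  star_continuous : ContinuousOn (fun p : ℝ × ℝ => star p.1 p.2)
    (Set.Icc (0:ℝ) 1 ×ˢ Set.Icc (0:ℝ) 1)
  M_pos : ∀ x y t, 0 < t → 0 < M x y t
  M_le_one : ∀ x y t, 0 < t → M x y t ≤ 1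
  M_eq_one_iff : ∀ x y t, 0 < t → (M x y t = 1 ↔ x = y)
  M_symm : ∀ x y t, 0 < t → M x y t = M y x t
  M_triangle : ∀ x y z t s, 0 < t → 0 < s → star (M x y t) (M y z s) ≤ M x z (t + s)
  M_continuousOn : ∀ x y, ContinuousOn (M x y) (Set.Ioi (0:ℝ))

namespace FuzzyMetric

variable {X : Type*}

/-- The open ball `B(x,r,t)`. -/
def ball (F : FuzzyMetric X) (x : X) (r t : ℝ) : Set X := {y | 1 - r < F.M x y t}

/-- The topology `τ_M` induced by the fuzzy metric (the balls form a base for it). -/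
def topology (F : FuzzyMetric X) : TopologicalSpace X :=
  TopologicalSpace.generateFrom
    {s | ∃ x : X, ∃ r t : ℝ, r ∈ Set.Ioo (0:ℝ) 1 ∧ 0 < t ∧ s = F.ball x r t}

/-- `f : X → ℝ` is `ℝ`-uniformly continuous. -/
def RUniformlyContinuous (F : FuzzyMetric X) (f : X → ℝ) : Prop :=
  ∀ ε > (0:ℝ), ∃ r ∈ Set.Ioo (0:ℝ) 1, ∃ s > (0:ℝ),
    ∀ x y : X, 1 - r < F.M x y s → |f x - f y| < ε

/-- The Lebesgue property: every open cover is refined by the family of balls of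
some fixed radius `r` and parameter `t`. -/
def Lebesgue (F : FuzzyMetric X) : Prop :=
  ∀ 𝒢 : Set (Set X), (∀ G ∈ 𝒢, F.topology.IsOpen G) → ⋃₀ 𝒢 = Set.univ →
    ∃ r ∈ Set.Ioo (0:ℝ) 1, ∃ t > (0:ℝ), ∀ x : X, ∃ G ∈ 𝒢, F.ball x r t ⊆ G

/-- A set `A ⊆ X` is fuzzy uniformly discrete. -/
def UniformlyDiscrete (F : FuzzyMetric X) (A : Set X) : Prop :=
  ∃ r ∈ Set.Ioo (0:ℝ) 1, ∃ s > (0:ℝ), ∀ x ∈ A, ∀ y ∈ A, x ≠ y → F.M x y s < 1 - r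

/-- The set `X'` of accumulation points of `(X, τ_M)`. -/
def derivedSet (F : FuzzyMetric X) : Set X :=
  {x | ∀ U : Set X, F.topology.IsOpen U → x ∈ U → ∃ y ∈ U, y ≠ x}

/-- A sequence is Cauchy in the fuzzy metric. -/
def IsCauchy (F : FuzzyMetric X) (u : ℕ → X) : Prop :=
  ∀ ε ∈ Set.Ioo (0:ℝ) 1, ∀ t > (0:ℝ), ∃ k : ℕ, ∀ m ≥ k, ∀ n ≥ k, 1 - ε < F.M (u m) (u n) t

/-- Sequential compactness: every sequence has a convergent subsequence. -/
def SeqCompact (F : FuzzyMetric X) : Prop :=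
  ∀ u : ℕ → X, ∃ x : X, ∃ φ : ℕ → ℕ, StrictMono φ ∧
    Filter.Tendsto (u ∘ φ) Filter.atTop (@nhds X F.topology x)

end FuzzyMetric

open scoped Uniformity

section UniformLebesgue

variable {X : Type*} [UniformSpace X]

/-- If every open cover is refined by the balls of some entourage, then every sequence of
non-isolated points has a cluster point. -/
theorem exists_mapClusterPt_of_lebesgue [T0Space X] [(𝓤 X).IsCountablyGenerated]
    (h : ∀ 𝒢 : Set (Set X), (∀ G ∈ 𝒢, IsOpen G) → ⋃₀ 𝒢 = univ →
      ∃ V ∈ 𝓤 X, ∀ x, ∃ G ∈ 𝒢, UniformSpace.ball x V ⊆ G)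
    (u : ℕ → X) (hu : ∀ n, ¬ IsOpen {u n}) : ∃ z, MapClusterPt z atTop u := by
  by_contra! hz
  obtain ⟨B, hB⟩ := (𝓤 X).exists_antitone_basis
  have hv : ∀ n, ∃ v ∈ UniformSpace.ball (u n) (B n), v ≠ u n := by
    intro n
    by_contra! hv
    refine hu n ((isOpen_singleton_iff_nhds_eq_pure _).2 (le_antisymm ?_ (pure_le_nhds _)))
    rw [Filter.le_pure_iff]
    exact mem_of_superset (UniformSpace.ball_mem_nhds _ (hB.1.mem_of_mem trivial)) hv
  choose v hv hne using hv
  obtain ⟨V, hV, hVG⟩ := h {U | IsOpen U ∧ ∀ n, u n ∈ U → v n ∉ U} (fun G hG ↦ hG.1) (by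
    refine eq_univ_of_forall fun z ↦ ?_
    have hz' := hz z
    rw [mapClusterPt_iff_frequently] at hz'
    push Not at hz'
    obtain ⟨s, hs, hsu⟩ := hz'
    obtain ⟨O, hOs, hO, hzO⟩ := mem_nhds_iff.1 hs
    obtain ⟨N, hN⟩ := eventually_atTop.1 hsu
    refine ⟨O \ ((u '' Iio N ∪ v '' Iio N) \ {z}),
      ⟨hO.sdiff (Set.Finite.isClosed ?_), ?_⟩, hzO, fun hz ↦ hz.2 rfl⟩
    · exact (((finite_Iio N).image u).union ((finite_Iio N).image v)).subset sdiff_subset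
    · rintro n ⟨hnO, hn⟩ ⟨-, hn'⟩
      have hnN : n < N := by
        by_contra! hle
        exact hN n hle (hOs hnO)
      have h1 : u n = z := by
        by_contra hc
        exact hn ⟨Or.inl ⟨n, hnN, rfl⟩, hc⟩
      have h2 : v n = z := by
        by_contra hc
        exact hn' ⟨Or.inr ⟨n, hnN, rfl⟩, hc⟩
      exact hne n (h2.trans h1.symm))
  obtain ⟨n, -, hn⟩ := hB.1.mem_iff.1 hV
  obtain ⟨G, hG, hsub⟩ := hVG (u n)
  exact hG.2 n (hsub (mem_of_mem_nhds (UniformSpace.ball_mem_nhds _ hV)))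
    (hsub (UniformSpace.ball_mono hn _ (hv n)))

theorem isClosed_setOf_not_isOpen_singleton : IsClosed {x : X | ¬ IsOpen {x}} := by
  rw [← isOpen_compl_iff, isOpen_iff_mem_nhds]
  intro x hx
  have hx' : IsOpen {x} := by simpa using hx
  refine mem_of_superset (hx'.mem_nhds rfl) ?_
  rintro y rfl
  exact hx

theorem lebesgue_iff_isCompact_isolation [T0Space X] [(𝓤 X).IsCountablyGenerated] :
    (∀ 𝒢 : Set (Set X), (∀ G ∈ 𝒢, IsOpen G) → ⋃₀ 𝒢 = univ →
      ∃ V ∈ 𝓤 X, ∀ x, ∃ G ∈ 𝒢, UniformSpace.ball x V ⊆ G) ↔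
    IsCompact {x : X | ¬ IsOpen {x}} ∧
      ∀ V ∈ 𝓤 X, ∃ W ∈ 𝓤 X, ∀ x, (∀ a ∈ {x : X | ¬ IsOpen {x}}, (x, a) ∉ V) →
        ∀ y, y ≠ x → (x, y) ∉ W := by
  constructor
  · intro h
    refine ⟨?_, fun V hV ↦ ?_⟩
    · rw [isCompact_iff_isSeqCompact]
      intro u hu
      obtain ⟨z, hz⟩ := exists_mapClusterPt_of_lebesgue h u hu
      obtain ⟨φ, hφ, hlim⟩ := hz.tendsto_subseq
      exact ⟨z, isClosed_setOf_not_isOpen_singleton.mem_of_tendsto hlim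
        (Eventually.of_forall fun n ↦ hu _), φ, hφ, hlim⟩
    · obtain ⟨W, hW, hWG⟩ := h {G | IsOpen G ∧ ∀ x ∈ G,
          (∀ a ∈ {x : X | ¬ IsOpen {x}}, (x, a) ∉ V) → G = {x}} (fun G hG ↦ hG.1) (by
        refine eq_univ_of_forall fun z ↦ ?_
        by_cases hz : IsOpen {z}
        · refine ⟨{z}, ⟨hz, ?_⟩, rfl⟩
          rintro x rfl -
          rfl
        · refine ⟨interior {x | (x, z) ∈ V}, ⟨isOpen_interior, fun x hx hxa ↦ ?_⟩, ?_⟩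
          · exact (hxa z hz (interior_subset (s := {x | (x, z) ∈ V}) hx)).elim
          · exact mem_interior_iff_mem_nhds.2 (mem_nhds_right z hV))
      refine ⟨W, hW, fun x hx y hy hxy ↦ hy ?_⟩
      obtain ⟨G, ⟨-, hG⟩, hsub⟩ := hWG x
      rw [hG x (hsub (mem_of_mem_nhds (UniformSpace.ball_mem_nhds _ hW))) hx] at hsub
      exact hsub hxy
  · rintro ⟨hK, h⟩ 𝒢 hopen hcov
    obtain ⟨V, hV, hVG⟩ := lebesgue_number_lemma_sUnion hK hopen
      (hcov.symm ▸ subset_univ _)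
    obtain ⟨V', hV', hsymm, hcomp⟩ := comp_symm_mem_uniformity_sets hV
    obtain ⟨W, hW, hWx⟩ := h V' hV'
    refine ⟨V' ∩ W, inter_mem hV' hW, fun x ↦ ?_⟩
    by_cases hx : ∃ a ∈ {x : X | ¬ IsOpen {x}}, (x, a) ∈ V'
    · obtain ⟨a, ha, hxa⟩ := hx
      obtain ⟨G, hG, hsub⟩ := hVG a ha
      exact ⟨G, hG, fun y hy ↦ hsub (hcomp ⟨x, hsymm.symm _ _ hxa, hy.1⟩)⟩
    · push Not at hx
      obtain ⟨G, hG, hxG⟩ : x ∈ ⋃₀ 𝒢 := hcov ▸ mem_univ x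
      refine ⟨G, hG, fun y hy ↦ ?_⟩
      by_cases hyx : y = x
      · rwa [hyx]
      · exact (hWx x hx y hyx hy.2).elim

end UniformLebesgue

namespace FuzzyMetric

variable {X : Type*} (F : FuzzyMetric X)

theorem M_self (x : X) {t : ℝ} (ht : 0 < t) : F.M x x t = 1 := (F.M_eq_one_iff x x t ht).2 rfl

theorem M_mem (x y : X) {t : ℝ} (ht : 0 < t) : F.M x y t ∈ Icc (0 : ℝ) 1 :=
  ⟨(F.M_pos x y t ht).le, F.M_le_one x y t ht⟩

theorem M_mono (x y : X) {s t : ℝ} (hs : 0 < s) (hst : s ≤ t) : F.M x y s ≤ F.M x y t := by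
  rcases hst.eq_or_lt with rfl | hlt
  · exact le_rfl
  · have := F.M_triangle x y y s (t - s) hs (sub_pos.2 hlt)
    rwa [F.M_self y (sub_pos.2 hlt), F.star_one _ (F.M_mem x y hs), add_sub_cancel] at this

theorem tendsto_star {a : ℝ} (ha : a ∈ Icc (0 : ℝ) 1) :
    Tendsto (fun s ↦ F.star a (1 - s)) (𝓝[Icc 0 1] 0) (𝓝 a) := by
  have h := F.star_continuous (a, 1) ⟨ha, by simp⟩
  simp only [ContinuousWithinAt, F.star_one a ha] at h
  refine h.comp (tendsto_nhdsWithin_iff.2 ⟨?_, ?_⟩ : Tendsto (fun s : ℝ ↦ (a, 1 - s)) _ _)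
  · refine Tendsto.mono_left ?_ nhdsWithin_le_nhds
    exact Continuous.tendsto' (by fun_prop) _ _ (by simp)
  · filter_upwards [self_mem_nhdsWithin] with s hs
    exact ⟨ha, by simpa using hs.2, by simpa using hs.1⟩

theorem exists_lt_star {a b : ℝ} (ha : a ∈ Icc (0 : ℝ) 1) (hb : b < a) :
    ∃ s ∈ Ioo (0 : ℝ) 1, b < F.star a (1 - s) := by
  have h := (F.tendsto_star ha).mono_left (nhdsWithin_mono 0 (Ioo_subset_Icc_self))
  have : (𝓝[Ioo (0 : ℝ) 1] 0).NeBot := by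
    rw [nhdsWithin_Ioo_eq_nhdsGT one_pos]
    infer_instance
  obtain ⟨s, hs, hbs⟩ := ((eventually_mem_nhdsWithin (a := (0 : ℝ)) (s := Ioo 0 1)).and (h.eventually_const_lt hb)).exists
  exact ⟨s, hs, hbs⟩

theorem star_le_M {x y z : X} {a b s t : ℝ} (ha : a ∈ Icc (0 : ℝ) 1) (hb : b ∈ Icc (0 : ℝ) 1)
    (hs : 0 < s) (ht : 0 < t) (hxy : a ≤ F.M x y s) (hyz : b ≤ F.M y z t) :
    F.star a b ≤ F.M x z (s + t) :=
  (F.star_mono _ _ _ _ ha (F.M_mem x y hs) hb (F.M_mem y z ht) hxy hyz).trans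
    (F.M_triangle x y z s t hs ht)

/-- The entourage of pairs at fuzzy distance controlled by `r` at parameter `t`. -/
def entourage (r t : ℝ) : Set (X × X) := {p | 1 - r < F.M p.1 p.2 t}

theorem entourage_mono {r r' t t' : ℝ} (hr : r ≤ r') (ht : 0 < t) (htt' : t ≤ t') :
    F.entourage r t ⊆ F.entourage r' t' := fun p hp ↦ by
  have := F.M_mono p.1 p.2 ht htt'
  simp only [entourage, mem_ofPred_eq] at hp ⊢
  linarith

theorem exists_ball_subset_ball {x y : X} {r t : ℝ} (ht : 0 < t)
    (hy : y ∈ F.ball x r t) : ∃ s ∈ Ioo (0 : ℝ) 1, ∃ t' > 0, F.ball y s t' ⊆ F.ball x r t := by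
  have hc : Tendsto (F.M x y) (𝓝[<] t) (𝓝 (F.M x y t)) :=
    ((F.M_continuousOn x y).continuousAt (Ioi_mem_nhds ht)).tendsto.mono_left nhdsWithin_le_nhds
  obtain ⟨t₀, hM, ht₀⟩ := ((hc.eventually_const_lt hy).and (Ioo_mem_nhdsLT ht)).exists
  obtain ⟨s, hs, hlt⟩ := F.exists_lt_star (F.M_mem x y ht₀.1) hM
  refine ⟨s, hs, t - t₀, sub_pos.2 ht₀.2, fun z hz ↦ hlt.trans_le ?_⟩
  have := F.star_le_M (F.M_mem x y ht₀.1) (⟨by linarith [hs.2], by linarith [hs.1]⟩ :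
    1 - s ∈ Icc (0 : ℝ) 1) ht₀.1 (sub_pos.2 ht₀.2) le_rfl (le_of_lt hz)
  rwa [add_sub_cancel] at this

theorem exists_star_self {r : ℝ} (hr : r ∈ Ioo (0 : ℝ) 1) :
    ∃ s ∈ Ioo (0 : ℝ) 1, 1 - r < F.star (1 - s) (1 - s) := by
  obtain ⟨a, ha⟩ := F.exists_lt_star (a := 1) (b := 1 - r) (by simp) (by linarith [hr.1])
  have ha' : 1 - a ∈ Icc (0 : ℝ) 1 := ⟨by linarith [ha.1.2], by linarith [ha.1.1]⟩
  rw [F.star_comm _ (by simp) _ ha', F.star_one _ ha'] at ha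
  obtain ⟨b, hb, hlt⟩ := F.exists_lt_star ha' ha.2
  have hm : min a b ∈ Ioo (0 : ℝ) 1 := ⟨lt_min ha.1.1 hb.1, min_lt_of_left_lt ha.1.2⟩
  have hm' : 1 - min a b ∈ Icc (0 : ℝ) 1 := ⟨by linarith [hm.2], by linarith [hm.1]⟩
  refine ⟨min a b, hm, hlt.trans_le (F.star_mono _ _ _ _ ha' hm' ⟨?_, ?_⟩ hm' ?_ ?_)⟩
  · linarith [hb.2]
  · linarith [hb.1]
  · linarith [min_le_left a b]
  · linarith [min_le_right a b]

/-- The filter of entourages of a fuzzy metric space. -/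
def uniformityFilter : Filter (X × X) :=
  ⨅ n : ℕ, 𝓟 (F.entourage (1 / (n + 2)) (1 / (n + 2)))

theorem mem_uniformityFilter {V : Set (X × X)} :
    V ∈ F.uniformityFilter ↔ ∃ r ∈ Ioo (0 : ℝ) 1, ∃ t > (0 : ℝ), F.entourage r t ⊆ V := by
  have hanti : Antitone fun n : ℕ ↦ F.entourage (1 / ((n : ℝ) + 2)) (1 / (n + 2)) := by
    intro m n hmn
    have : 1 / ((n : ℝ) + 2) ≤ 1 / (m + 2) := by gcongr
    exact F.entourage_mono this (by positivity) this
  have hb := hasBasis_iInf_principal (directed_of_isDirected_le hanti)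
  rw [uniformityFilter, hb.mem_iff]
  constructor
  · rintro ⟨n, -, hn⟩
    have hn2 : (0 : ℝ) < n + 2 := by positivity
    refine ⟨_, ⟨by positivity, ?_⟩, _, ?_, hn⟩
    · rw [div_lt_one hn2]
      linarith [n.cast_nonneg (α := ℝ)]
    · positivity
  · rintro ⟨r, hr, t, ht, hV⟩
    obtain ⟨n, hn⟩ := exists_nat_one_div_lt (lt_min hr.1 ht)
    have hle : 1 / ((n : ℝ) + 2) ≤ min r t := by
      refine le_trans ?_ hn.le
      gcongr
      norm_num
    exact ⟨n, trivial, (F.entourage_mono (hle.trans (min_le_left _ _)) (by positivity)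
      (hle.trans (min_le_right _ _))).trans hV⟩

theorem entourage_mem {r t : ℝ} (hr : r ∈ Ioo (0 : ℝ) 1) (ht : 0 < t) :
    F.entourage r t ∈ F.uniformityFilter :=
  F.mem_uniformityFilter.2 ⟨r, hr, t, ht, Subset.rfl⟩

/-- The uniform structure of a fuzzy metric space, inducing the topology `τ_M`. -/
@[reducible]
def uniformSpace : UniformSpace X where
  toTopologicalSpace := F.topology
  uniformity := F.uniformityFilter
  symm := by
    intro V hV
    obtain ⟨r, hr, t, ht, hsub⟩ := F.mem_uniformityFilter.1 hV
    refine mem_map.2 (mem_of_superset (F.entourage_mem hr ht) fun p hp ↦ hsub ?_)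
    simp only [entourage, mem_ofPred_eq] at hp ⊢
    rwa [F.M_symm _ _ _ ht]
  comp := by
    intro V hV
    obtain ⟨r, hr, t, ht, hsub⟩ := F.mem_uniformityFilter.1 hV
    obtain ⟨s, hs, hlt⟩ := F.exists_star_self hr
    have hs' : 1 - s ∈ Icc (0 : ℝ) 1 := ⟨by linarith [hs.2], by linarith [hs.1]⟩
    refine mem_of_superset (mem_lift' (F.entourage_mem hs (half_pos ht))) ?_
    rintro ⟨x, z⟩ ⟨y, hxy, hyz⟩
    have := F.star_le_M hs' hs' (half_pos ht) (half_pos ht) (le_of_lt hxy) (le_of_lt hyz)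
    rw [add_halves] at this
    exact hsub (hlt.trans_le this)
  nhds_eq_comap_uniformity := by
    intro x
    apply le_antisymm
    · rintro U ⟨V, hV, hU⟩
      obtain ⟨r, hr, t, ht, hsub⟩ := F.mem_uniformityFilter.1 hV
      refine mem_of_superset (@IsOpen.mem_nhds X F.topology x (F.ball x r t)
        (TopologicalSpace.isOpen_generateFrom_of_mem ⟨x, r, t, hr, ht, rfl⟩) ?_)
        fun y hy ↦ hU (hsub hy)
      simp only [ball, mem_ofPred_eq, F.M_self x ht]
      linarith [hr.1]
    · rw [topology, TopologicalSpace.nhds_generateFrom]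
      refine le_iInf₂ fun U hU ↦ le_principal_iff.2 ?_
      obtain ⟨hxU, z, r, t, -, ht, rfl⟩ := hU
      obtain ⟨s, hs, t', ht', hsub⟩ := F.exists_ball_subset_ball ht hxU
      exact ⟨_, F.entourage_mem hs ht', fun y hy ↦ hsub hy⟩

theorem derivedSet_eq : F.derivedSet = {x | ¬ F.topology.IsOpen {x}} := by
  ext x
  constructor
  · intro hx ho
    obtain ⟨y, hy, hne⟩ := hx {x} ho rfl
    exact hne hy
  · intro hx U hU hxU
    by_contra! hc
    refine hx ?_
    rwa [← eq_singleton_iff_unique_mem.2 ⟨hxU, hc⟩]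

end FuzzyMetric

/-- A fuzzy metric space is Lebesgue iff `X'` is compact and for all `δ₁ ∈ (0,1)`,
`t₁ > 0` there exist `δ₂ ∈ (0,1)`, `t₂ > 0` such that every `x` with
`sup_{a ∈ X'} M(x,a,t₁) ≤ 1 - δ₁` satisfies `sup_{y ≠ x} M(x,y,t₂) ≤ 1 - δ₂`. -/
theorem lebesgue_iff_derivedSet_compact_isolation {X : Type*} [Nonempty X]
    (F : FuzzyMetric X) :
    F.Lebesgue ↔
      (@IsCompact X F.topology F.derivedSet ∧
        ∀ δ₁ ∈ Set.Ioo (0:ℝ) 1, ∀ t₁ > (0:ℝ), ∃ δ₂ ∈ Set.Ioo (0:ℝ) 1, ∃ t₂ > (0:ℝ),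
          ∀ x : X, (∀ a ∈ F.derivedSet, F.M x a t₁ ≤ 1 - δ₁) →
            ∀ y : X, y ≠ x → F.M x y t₂ ≤ 1 - δ₂) := by
  let := F.uniformSpace
  have hcount : (𝓤 X).IsCountablyGenerated :=
    inferInstanceAs (⨅ n : ℕ, 𝓟 (F.entourage (1 / (n + 2)) (1 / (n + 2)))).IsCountablyGenerated
  have hT0 : T0Space X := by
    refine t0Space_iff_uniformity.2 fun x y hxy ↦ ?_
    by_contra hne
    have hlt : F.M x y 1 < 1 := lt_of_le_of_ne (F.M_le_one x y 1 one_pos)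
      (mt (F.M_eq_one_iff x y 1 one_pos).1 hne)
    have hpos := F.M_pos x y 1 one_pos
    have h : 1 - (1 - F.M x y 1) < F.M x y 1 := hxy _
      (F.entourage_mem ⟨by linarith, by linarith⟩ one_pos)
    linarith
  rw [F.derivedSet_eq]
  refine Iff.trans ?_ (lebesgue_iff_isCompact_isolation (X := X)) |>.trans (and_congr Iff.rfl ?_)
  · refine forall₃_congr fun 𝒢 _ _ ↦ ⟨?_, ?_⟩
    · rintro ⟨r, hr, t, ht, h⟩
      exact ⟨_, F.entourage_mem hr ht, h⟩
    · rintro ⟨V, hV, h⟩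
      obtain ⟨r, hr, t, ht, hsub⟩ := F.mem_uniformityFilter.1 hV
      refine ⟨r, hr, t, ht, fun x ↦ ?_⟩
      obtain ⟨G, hG, hG'⟩ := h x
      exact ⟨G, hG, fun y hy ↦ hG' (hsub hy)⟩
  · constructor
    · intro h δ hδ t ht
      obtain ⟨W, hW, hx⟩ := h _ (F.entourage_mem hδ ht)
      obtain ⟨r, hr, t', ht', hsub⟩ := F.mem_uniformityFilter.1 hW
      exact ⟨r, hr, t', ht', fun x hxa y hy ↦ not_lt.1 fun hlt ↦
        hx x (fun a ha ↦ not_lt.2 (hxa a ha)) y hy (hsub hlt)⟩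
    · intro h V hV
      obtain ⟨r, hr, t, ht, hsub⟩ := F.mem_uniformityFilter.1 hV
      obtain ⟨δ, hδ, t', ht', hx⟩ := h r hr t ht
      exact ⟨_, F.entourage_mem hδ ht', fun x hxa y hy ↦ not_lt.2
        (hx x (fun a ha ↦ not_lt.1 fun hlt ↦ hxa a ha (hsub hlt)) y hy)⟩
end

section
/- Let Y = (0,1] be endowed with the usual metric ρ(x,y) = |x−y| and let M_ρ(x,y,t) = t/(t+|x−y|) be the induced standard fuzzy metric on Y with the continuous t-norm given by ordinary multiplication on [0,1]. The set A = {1/n : n ∈ ℕ} is closed and discrete in (Y,ρ) but is not fuzzy uniformly discrete in (Y,M_ρ,·): there do not exist r ∈ (0,1) and t > 0 such that t/(t+|x−y|) < 1−r for all distinct x,y ∈ A. -/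
theorem continuous_inv_coe_Ioc :
    Continuous fun y : ↥(Set.Ioc (0:ℝ) 1) => (y : ℝ)⁻¹ :=
  continuous_subtype_val.inv₀ fun y => y.2.1.ne'

theorem setOf_eq_one_div_nat_eq_preimage :
    {y : ↥(Set.Ioc (0:ℝ) 1) | ∃ n : ℕ, 0 < n ∧ (y : ℝ) = 1 / n} =
      (fun y : ↥(Set.Ioc (0:ℝ) 1) => (y : ℝ)⁻¹) ⁻¹' Set.range ((↑) : ℤ → ℝ) := by
  ext y
  constructor
  · rintro ⟨n, -, hy⟩
    exact ⟨n, by simp [hy]⟩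
  · rintro ⟨m, hm⟩
    have hpos : (0 : ℝ) < m := hm ▸ inv_pos.mpr y.2.1
    lift m to ℕ using (Int.cast_pos.mp hpos).le
    refine ⟨m, by exact_mod_cast hpos, ?_⟩
    rw [one_div, ← inv_inv (y : ℝ), inv_inj]
    simpa using hm.symm

/-- Example: in `Y = (0,1]` with the standard fuzzy metric `M_ρ(x,y,t) = t/(t+|x-y|)`
induced by the usual metric, the set `A = {1/n : n ∈ ℕ}` is closed and discrete in
`(Y,ρ)` but not fuzzy uniformly discrete in `(Y, M_ρ, ·)`. -/
theorem example_closed_discrete_not_uniformlyDiscrete :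
    IsClosed {y : ↥(Set.Ioc (0:ℝ) 1) | ∃ n : ℕ, 0 < n ∧ (y : ℝ) = 1 / n} ∧
    (∀ a ∈ {y : ↥(Set.Ioc (0:ℝ) 1) | ∃ n : ℕ, 0 < n ∧ (y : ℝ) = 1 / n},
      ∃ U : Set ↥(Set.Ioc (0:ℝ) 1), IsOpen U ∧
        U ∩ {y : ↥(Set.Ioc (0:ℝ) 1) | ∃ n : ℕ, 0 < n ∧ (y : ℝ) = 1 / n} = {a}) ∧
    ¬ ∃ r ∈ Set.Ioo (0:ℝ) 1, ∃ t > (0:ℝ),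
        ∀ x ∈ {y : ↥(Set.Ioc (0:ℝ) 1) | ∃ n : ℕ, 0 < n ∧ (y : ℝ) = 1 / n},
          ∀ y ∈ {y : ↥(Set.Ioc (0:ℝ) 1) | ∃ n : ℕ, 0 < n ∧ (y : ℝ) = 1 / n},
            x ≠ y → t / (t + |(x : ℝ) - (y : ℝ)|) < 1 - r := by
  refine ⟨?_, ?_, ?_⟩
  · rw [setOf_eq_one_div_nat_eq_preimage]
    exact Int.isClosedEmbedding_coe_real.isClosed_range.preimage continuous_inv_coe_Ioc
  · rw [setOf_eq_one_div_nat_eq_preimage]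
    rintro a ⟨m, hm⟩
    refine ⟨(fun y : ↥(Set.Ioc (0:ℝ) 1) => (y : ℝ)⁻¹) ⁻¹' Metric.ball (m : ℝ) 1,
      Metric.isOpen_ball.preimage continuous_inv_coe_Ioc, ?_⟩
    ext y
    constructor
    · rintro ⟨hy, k, hk⟩
      have hdist : |(k : ℝ) - m| < 1 := by
        rw [← Real.dist_eq, hk]
        exact hy
      have hkm : k = m := by
        rw [← sub_eq_zero, ← Int.abs_lt_one_iff]
        exact_mod_cast hdist
      subst hkm
      exact Subtype.ext (inv_injective (hk.symm.trans hm))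
    · rintro rfl
      exact ⟨by simp [← hm], m, hm⟩
  · rintro ⟨r, ⟨hr, -⟩, t, ht, h⟩
    obtain ⟨n, hn⟩ := exists_nat_one_div_lt (mul_pos hr ht)
    have hmem (k : ℕ) : (1 / ((k + 1 : ℕ) : ℝ)) ∈ Set.Ioc (0:ℝ) 1 :=
      ⟨by positivity, by
        rw [div_le_one (by positivity)]
        exact_mod_cast Nat.le_add_left 1 k⟩
    have hlt : 1 / ((n + 1 + 1 : ℕ) : ℝ) < 1 / ((n + 1 : ℕ) : ℝ) :=
      one_div_lt_one_div_of_lt (by positivity) (by exact_mod_cast Nat.lt_succ_self _)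
    have hM := h ⟨_, hmem n⟩ ⟨n + 1, n.succ_pos, rfl⟩ ⟨_, hmem (n + 1)⟩
      ⟨n + 1 + 1, (n + 1).succ_pos, rfl⟩ fun he => hlt.ne' (congrArg Subtype.val he)
    have hd : |1 / ((n + 1 : ℕ) : ℝ) - 1 / ((n + 1 + 1 : ℕ) : ℝ)| < r * t := by
      have hpos := (hmem (n + 1)).1
      rw [abs_of_pos (sub_pos.mpr hlt)]
      push_cast at hn hpos ⊢
      linarith
    have hd0 := abs_nonneg (1 / ((n + 1 : ℕ) : ℝ) - 1 / ((n + 1 + 1 : ℕ) : ℝ))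
    rw [div_lt_iff₀ (by positivity)] at hM
    nlinarith [mul_nonneg hr.le hd0]
end

section
/- Let Y = (0,1] be endowed with the usual metric ρ(x,y) = |x−y| and let M_ρ(x,y,t) = t/(t+|x−y|) be the induced standard fuzzy metric on Y with the continuous t-norm given by ordinary multiplication on [0,1]. Then the fuzzy metric space (Y,M_ρ,·) is not Lebesgue. -/
/-- The standard fuzzy metric on `Y = (0,1]` induced by the usual metric. -/
noncomputable def Mrho (x y : ↥(Set.Ioc (0:ℝ) 1)) (t : ℝ) : ℝ := t / (t + |(x : ℝ) - (y : ℝ)|)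

/-- The ball `B(x,r,t)` of the standard fuzzy metric on `(0,1]`. -/
noncomputable def ballRho (x : ↥(Set.Ioc (0:ℝ) 1)) (r t : ℝ) : Set ↥(Set.Ioc (0:ℝ) 1) :=
  {y | 1 - r < Mrho x y t}

/-- The topology induced by the standard fuzzy metric on `(0,1]`. -/
noncomputable def tauRho : TopologicalSpace ↥(Set.Ioc (0:ℝ) 1) :=
  TopologicalSpace.generateFrom
    {s | ∃ x : ↥(Set.Ioc (0:ℝ) 1), ∃ r t : ℝ, r ∈ Set.Ioo (0:ℝ) 1 ∧ 0 < t ∧ s = ballRho x r t}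

theorem mem_ballRho_iff {x y : ↥(Set.Ioc (0:ℝ) 1)} {r t : ℝ} (ht : 0 < t) :
    y ∈ ballRho x r t ↔ (1 - r) * (t + |(x : ℝ) - (y : ℝ)|) < t := by
  have h : 0 < t + |(x : ℝ) - (y : ℝ)| := by positivity
  exact lt_div_iff₀ h

/-- The fuzzy metric space `((0,1], M_ρ, ·)` is not Lebesgue. -/
theorem Ioc_standard_fuzzy_not_lebesgue :
    ¬ (∀ 𝒢 : Set (Set ↥(Set.Ioc (0:ℝ) 1)),
        (∀ G ∈ 𝒢, tauRho.IsOpen G) → ⋃₀ 𝒢 = Set.univ →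
        ∃ r ∈ Set.Ioo (0:ℝ) 1, ∃ t > (0:ℝ),
          ∀ x : ↥(Set.Ioc (0:ℝ) 1), ∃ G ∈ 𝒢, ballRho x r t ⊆ G) := by
  intro h
  obtain ⟨r, ⟨hr0, hr1⟩, t, ht, H⟩ := h
    (Set.range fun x : ↥(Set.Ioc (0:ℝ) 1) => ballRho x (1 / 2) ((x : ℝ) / 2))
    (by
      rintro _ ⟨x, rfl⟩
      exact TopologicalSpace.GenerateOpen.basic _
        ⟨x, 1 / 2, (x : ℝ) / 2, by norm_num, half_pos x.2.1, rfl⟩)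
    (by
      refine Set.eq_univ_of_forall fun x => ⟨_, ⟨x, rfl⟩, ?_⟩
      have hx := x.2.1
      rw [mem_ballRho_iff (half_pos hx), sub_self, abs_zero]
      linarith)
  have htr : 0 < t * r := mul_pos ht hr0
  have hδ : 0 < min 1 (t * r) := lt_min one_pos htr
  obtain ⟨_, ⟨z, rfl⟩, hz⟩ := H ⟨min 1 (t * r), hδ, min_le_left _ _⟩
  have hz0 := z.2.1
  have hy : 0 < min (min 1 (t * r)) ((z : ℝ) / 2) := lt_min hδ (half_pos hz0)
  have hyδ := min_le_left (min 1 (t * r)) ((z : ℝ) / 2)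
  have hyz := min_le_right (min 1 (t * r)) ((z : ℝ) / 2)
  have hδr := min_le_right 1 (t * r)
  have hmem := @hz ⟨_, hy, hyδ.trans (min_le_left _ _)⟩ (by
    rw [mem_ballRho_iff ht]
    dsimp only
    rw [abs_of_nonneg (sub_nonneg.2 hyδ)]
    calc _ ≤ (1 - r) * (t + t * r) :=
          mul_le_mul_of_nonneg_left (by linarith) (by linarith)
      _ = t - t * r * r := by ring
      _ < t := sub_lt_self _ (mul_pos htr hr0))
  rw [mem_ballRho_iff (half_pos hz0)] at hmem
  dsimp only at hmem
  have hle := le_abs_self ((z : ℝ) - min (min 1 (t * r)) ((z : ℝ) / 2))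
  linarith
end
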